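/- For every M ≥ 2 and α_0 > 0, if k = 5 there exist constants c_0 > 0, b > 0 and 0 < δ < 1/k such that, setting A_{j,n₁} = (1/j)·⟨Λ(e_1) − Λ(σ_n), Λ(e_j)⟩_{ℓ²} with n₁ = n+2 and σ_n = Σ_{j=0}^n (b/(j+2)) e_{j+2}, the following hold for every n ≥ 0: |A_{j,n₁}| ≤ A_{n₁,n₁} = 1/(2λ_n) = M²/(2α_0 M^{n₁}) for every j ∈ ℕ; moreover, writing j(n₁) = min{ j : 2 ≤ j ≤ n₁, A_{j,n₁} ≠ 0 }, one has 0 < A_{1,n₁} < A_{j(n₁),n₁}, A_{j,n₁} < A_{j+1,n₁} for every j(n₁) ≤ j < n₁, 0 < A_{1,n₁}+A_{j(n₁),n₁} < A_{j(n₁)+1,n₁} if j(n₁) < n₁, and 0 < A_{j+1,n₁} < A_{j,n₁} for every j ≥ n₁. -/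

import Mathlib

open Filter Finset
open scoped ENNReal Topology

noncomputable section

def Acoef (k : ℕ) (δ : ℝ) (i : ℕ) : ℝ :=
  if i = 1 then 1 - k * δ else if i = k then 2 * δ else δ

def Ccoef (k : ℕ) (δ : ℝ) (m : ℕ) : ℝ := ∑ i ∈ Finset.Icc 1 m, Acoef k δ i

def eta (c0 M : ℝ) (j : ℕ) : ℝ := Real.sqrt (c0 / M ^ j)

def mu (c0 M δ : ℝ) (j : ℕ) : ℝ := -δ * eta c0 M j

/-- The `m`-th coordinate (paper indices) of `Λ e_j`. -/
def lamCoord (c0 M δ b : ℝ) (k j m : ℕ) : ℝ :=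
  if j = 1 then
    (if 1 ≤ m ∧ m ≤ k then Ccoef k δ m * eta c0 M m
      else if k + 1 ≤ m then eta c0 M m else 0) +
      (if m = k then mu c0 M δ k else 0)
  else
    ((j : ℝ) / b) *
      ((if j - 1 ≤ m ∧ m ≤ j + k - 2 then Acoef k δ (m + 2 - j) * eta c0 M m else 0) +
        (if m = j + k - 2 then mu c0 M δ m else 0) -
        (if m = j + k - 1 then mu c0 M δ m else 0))

def lpSpec (c0 M δ b : ℝ) (k : ℕ)
    (Λ : lp (fun _ : ℕ => ℝ) 1 →L[ℝ] lp (fun _ : ℕ => ℝ) 2) : Prop :=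
  ∀ j m : ℕ, (Λ (lp.single 1 j 1)) m = lamCoord c0 M δ b k (j + 1) (m + 1)

/-- `u_j = (b/(j+2)) e_{j+2}`. -/
def useq (b : ℝ) (j : ℕ) : lp (fun _ : ℕ => ℝ) 1 :=
  (b / ((j : ℝ) + 2)) • lp.single 1 (j + 1) 1

/-- `A_{j,n₁} = (1/j) ⟨Λ e₁ − Λ σ_n, Λ e_j⟩` with `σ_n = ∑_{i=0}^n u_i` and `n₁ = n+2`.
Here the Lean index `j : ℕ` corresponds to the paper index `j + 1`. -/
def Acal (c0 M δ b : ℝ) (k : ℕ)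
    (Λ : lp (fun _ : ℕ => ℝ) 1 →L[ℝ] lp (fun _ : ℕ => ℝ) 2) (n j : ℕ) : ℝ :=
  (1 / ((j : ℝ) + 1)) *
    @inner ℝ _ _ (Λ (lp.single 1 0 1) - Λ (∑ i ∈ Finset.range (n + 1), useq b i))
      (Λ (lp.single 1 j 1))

/-- The weights, for `k = 5` and `δ = 11/60`, of the coordinates of `(b / j) Λ e_j`, `j ≥ 2`. -/
def stepWeight (s : ℕ) : ℝ := if s = 0 then 1 / 12 else if s ≤ 5 then 11 / 60 else 0

/-- Partial sums of `stepWeight`: the weights of the coordinates of `Λ e_1`. -/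
def stepMass (r : ℕ) : ℝ := ∑ s ∈ Finset.range (r + 1), stepWeight s

/-- The geometrically damped partial sums `q ^ r * stepMass r`. -/
def dampedMass (q : ℝ) (r : ℕ) : ℝ := q ^ r * stepMass r

lemma stepWeight_nonneg (s : ℕ) : 0 ≤ stepWeight s := by
  unfold stepWeight; split_ifs <;> norm_num

lemma stepWeight_of_gt {s : ℕ} (hs : 5 < s) : stepWeight s = 0 := by
  unfold stepWeight; rw [if_neg (by omega), if_neg (by omega)]

lemma stepMass_succ (r : ℕ) : stepMass (r + 1) = stepMass r + stepWeight (r + 1) := by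
  unfold stepMass; rw [Finset.sum_range_succ]

lemma stepMass_zero : stepMass 0 = 1 / 12 := by simp [stepMass, stepWeight]

lemma stepMass_of_five_le {r : ℕ} (hr : 5 ≤ r) : stepMass r = 1 := by
  induction r, hr using Nat.le_induction with
  | base => norm_num [stepMass, Finset.sum_range_succ, stepWeight]
  | succ r hr ih => rw [stepMass_succ, ih, stepWeight_of_gt (by omega), add_zero]

lemma stepMass_monotone : Monotone stepMass :=
  monotone_nat_of_le_succ fun r => by
    rw [stepMass_succ]; linarith [stepWeight_nonneg (r + 1)]

lemma stepMass_ge (r : ℕ) : 1 / 12 ≤ stepMass r :=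
  stepMass_zero ▸ stepMass_monotone (Nat.zero_le r)

lemma stepMass_le_one (r : ℕ) : stepMass r ≤ 1 :=
  (stepMass_monotone (Nat.le_add_right r 5)).trans_eq (stepMass_of_five_le (by omega))

lemma lamCoord_one (c0 M b : ℝ) (m : ℕ) :
    lamCoord c0 M (11 / 60) b 5 1 (m + 1) = stepMass m * eta c0 M (m + 1) := by
  rcases lt_or_ge m 5 with hm | hm
  · interval_cases m <;>
      norm_num [lamCoord, Ccoef, Acoef, mu, stepMass, stepWeight, Finset.sum_range_succ,
        Finset.sum_Icc_succ_top] <;> ring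
  · rw [stepMass_of_five_le hm, lamCoord, if_pos rfl, if_neg (by omega), if_pos (by omega),
      if_neg (by omega)]
    ring

lemma lamCoord_add_two (c0 M b : ℝ) (i m : ℕ) :
    lamCoord c0 M (11 / 60) b 5 (i + 2) (m + 1) =
      ((i : ℝ) + 2) / b * (if i ≤ m then stepWeight (m - i) * eta c0 M (m + 1) else 0) := by
  rw [lamCoord, if_neg (by omega)]
  push_cast
  congr 1
  by_cases him : i ≤ m
  · obtain ⟨s, rfl⟩ := Nat.exists_eq_add_of_le him
    rw [if_pos him, show i + s - i = s by omega, show i + s + 1 - i = s + 1 by omega]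
    rcases lt_or_ge 5 s with hs | hs
    · rw [stepWeight_of_gt hs, if_neg (by omega), if_neg (by omega), if_neg (by omega)]
      ring
    · rcases (show s = 5 ∨ s = 4 ∨ s < 4 by omega) with rfl | rfl | hs4
      · rw [if_neg (by omega), if_neg (by omega), if_pos (by omega)]
        norm_num [mu, stepWeight]
      · rw [if_pos (by omega), if_pos (by omega), if_neg (by omega)]
        norm_num [mu, stepWeight, Acoef]; ring
      · rw [if_pos (by omega), if_neg (by omega), if_neg (by omega)]
        interval_cases s <;> norm_num [stepWeight, Acoef]
  · rw [if_neg him, if_neg (by omega), if_neg (by omega), if_neg (by omega)]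
    ring

lemma stepMass_sub_sum (m N : ℕ) :
    stepMass m - ∑ i ∈ Finset.range N, (if i ≤ m then stepWeight (m - i) else 0) =
      if N ≤ m then stepMass (m - N) else 0 := by
  induction N with
  | zero => simp
  | succ N ih =>
    rw [Finset.sum_range_succ, ← sub_sub, ih]
    rcases lt_trichotomy N m with h | rfl | h
    · obtain ⟨r, rfl⟩ := Nat.exists_eq_add_of_lt h
      rw [if_pos (by omega), if_pos (by omega), if_pos (by omega),
        show N + r + 1 - N = r + 1 by omega, show N + r + 1 - (N + 1) = r by omega, stepMass_succ]
      ring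
    · simp [stepMass]
    · rw [if_neg (by omega), if_neg (by omega), if_neg (by omega)]
      ring

section Operator

variable {c0 M b : ℝ} {Λ : lp (fun _ : ℕ => ℝ) 1 →L[ℝ] lp (fun _ : ℕ => ℝ) 2}

lemma residual_coord (hb : b ≠ 0) (hΛ : lpSpec c0 M (11 / 60) b 5 Λ) (N m : ℕ) :
    (Λ (lp.single 1 0 1) - Λ (∑ i ∈ Finset.range N, useq b i)) m =
      (if N ≤ m then stepMass (m - N) else 0) * eta c0 M (m + 1) := by
  have h1 := hΛ 0 m
  rw [zero_add, lamCoord_one] at h1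
  have h2 : (Λ (∑ i ∈ Finset.range N, useq b i)) m =
      (∑ i ∈ Finset.range N, (if i ≤ m then stepWeight (m - i) else 0)) * eta c0 M (m + 1) := by
    rw [map_sum, lp.coeFn_sum, Finset.sum_apply, Finset.sum_mul]
    refine Finset.sum_congr rfl fun i _ => ?_
    rw [useq, map_smul, lp.coeFn_smul, Pi.smul_apply, smul_eq_mul, hΛ, lamCoord_add_two]
    have : (i : ℝ) + 2 ≠ 0 := by positivity
    split_ifs
    · field_simp
    · ring
  rw [lp.coeFn_sub, Pi.sub_apply, h1, h2, ← sub_mul, stepMass_sub_sum]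

lemma eta_sq (hc : 0 ≤ c0) (hM : 0 ≤ M) (m : ℕ) : eta c0 M m * eta c0 M m = c0 * M⁻¹ ^ m := by
  rw [eta, Real.mul_self_sqrt (by positivity), inv_pow, div_eq_mul_inv]

lemma Acal_succ (hb : b ≠ 0) (hc : 0 ≤ c0) (hM : 0 ≤ M) (hΛ : lpSpec c0 M (11 / 60) b 5 Λ)
    (n i : ℕ) :
    Acal c0 M (11 / 60) b 5 Λ n (i + 1) =
      1 / b * ∑ s ∈ Finset.range 6, c0 * M⁻¹ ^ (i + s + 1) *
        (if n + 1 ≤ i + s then stepMass (i + s - (n + 1)) else 0) * stepWeight s := by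
  have hi : (i : ℝ) + 2 ≠ 0 := by positivity
  have key : ∀ m, inner ℝ ((Λ (lp.single 1 0 1) -
        Λ (∑ i ∈ Finset.range (n + 1), useq b i)) m) ((Λ (lp.single 1 (i + 1) 1)) m) =
      ((i : ℝ) + 2) / b * (c0 * M⁻¹ ^ (m + 1) *
        (if n + 1 ≤ m then stepMass (m - (n + 1)) else 0) *
        (if i ≤ m then stepWeight (m - i) else 0)) := by
    intro m
    rw [residual_coord hb hΛ, hΛ, lamCoord_add_two, ← eta_sq hc hM]
    simp only [RCLike.inner_apply, conj_trivial]
    split_ifs <;> ring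
  rw [Acal, lp.inner_eq_tsum]
  simp_rw [key]
  rw [tsum_mul_left, ← Summable.sum_add_tsum_nat_add' (k := i), Finset.sum_eq_zero, zero_add,
    tsum_eq_sum (s := Finset.range 6)]
  · push_cast
    rw [show (i : ℝ) + 1 + 1 = i + 2 by ring, ← mul_assoc,
      show 1 / ((i : ℝ) + 2) * ((i + 2) / b) = 1 / b by field_simp]
    congr 1
    refine Finset.sum_congr rfl fun s _ => ?_
    rw [if_pos (Nat.le_add_left i s), Nat.add_sub_cancel, add_comm s i]
  · intro s hs
    rw [Finset.mem_range, not_lt] at hs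
    rw [if_pos (Nat.le_add_left i s), Nat.add_sub_cancel, stepWeight_of_gt hs, mul_zero]
  · intro m hm
    rw [Finset.mem_range] at hm
    rw [if_neg (show ¬ i ≤ m by omega), mul_zero]
  · refine summable_of_ne_finset_zero (s := Finset.range 6) fun s hs => ?_
    rw [Finset.mem_range, not_lt] at hs
    rw [if_pos (Nat.le_add_left i s), Nat.add_sub_cancel, stepWeight_of_gt hs, mul_zero]

lemma Acal_add (hb : b ≠ 0) (hc : 0 ≤ c0) (hM : 0 ≤ M) (hΛ : lpSpec c0 M (11 / 60) b 5 Λ)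
    (n t : ℕ) :
    Acal c0 M (11 / 60) b 5 Λ n (n + 2 + t) =
      c0 * M⁻¹ ^ (n + 2) / b *
        ∑ s ∈ Finset.range 6, dampedMass M⁻¹ (t + s) * stepWeight s := by
  rw [show n + 2 + t = (n + 1 + t) + 1 by ring, Acal_succ hb hc hM hΛ, Finset.mul_sum,
    Finset.mul_sum]
  refine Finset.sum_congr rfl fun s _ => ?_
  rw [if_pos (by omega), show n + 1 + t + s - (n + 1) = t + s by omega, dampedMass]
  ring

lemma Acal_sub (hb : b ≠ 0) (hc : 0 ≤ c0) (hM : 0 ≤ M) (hΛ : lpSpec c0 M (11 / 60) b 5 Λ)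
    {n i t : ℕ} (hit : i + t = n) :
    Acal c0 M (11 / 60) b 5 Λ n (i + 1) =
      c0 * M⁻¹ ^ (n + 2) / b *
        (11 / 60 * ∑ r ∈ Finset.range (5 - t), dampedMass M⁻¹ r) := by
  subst hit
  rw [Acal_succ hb hc hM hΛ]
  rcases le_or_gt 5 t with ht | ht
  · rw [Finset.sum_eq_zero]
    · rw [show 5 - t = 0 by omega]; simp
    · intro s hs
      rw [Finset.mem_range] at hs
      rw [if_neg (by omega)]; ring
  · rw [show 6 = (t + 1) + (5 - t) by omega, Finset.sum_range_add, Finset.sum_eq_zero, zero_add,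
      Finset.mul_sum, Finset.mul_sum, Finset.mul_sum]
    · refine Finset.sum_congr rfl fun r hr => ?_
      rw [Finset.mem_range] at hr
      rw [if_pos (by omega), show i + (t + 1 + r) - (i + t + 1) = r by omega, dampedMass,
        stepWeight, if_neg (by omega), if_pos (by omega)]
      ring
    · intro s hs
      rw [Finset.mem_range] at hs
      rw [if_neg (by omega)]; ring

lemma Acal_zero_bounds (hb : b ≠ 0) (hc : 0 < c0) (hM : 2 ≤ M)
    (hΛ : lpSpec c0 M (11 / 60) b 5 Λ) (n : ℕ) :
    0 < Acal c0 M (11 / 60) b 5 Λ n 0 ∧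
      Acal c0 M (11 / 60) b 5 Λ n 0 ≤ 2 * (c0 * M⁻¹ ^ (n + 2)) := by
  have hq0 : 0 < M⁻¹ := by positivity
  have hq : M⁻¹ ≤ 1 / 2 := by
    rw [one_div]; exact inv_anti₀ (by norm_num) hM
  have key : ∀ m, inner ℝ ((Λ (lp.single 1 0 1) -
        Λ (∑ i ∈ Finset.range (n + 1), useq b i)) m) ((Λ (lp.single 1 0 1)) m) =
      c0 * M⁻¹ ^ (m + 1) * (if n + 1 ≤ m then stepMass (m - (n + 1)) else 0) * stepMass m := by
    intro m
    rw [residual_coord hb hΛ, hΛ, zero_add, lamCoord_one, ← eta_sq hc.le (by linarith)]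
    simp only [RCLike.inner_apply, conj_trivial]
    ring
  have hsum := lp.summable_inner (𝕜 := ℝ) (Λ (lp.single 1 0 1) -
    Λ (∑ i ∈ Finset.range (n + 1), useq b i)) (Λ (lp.single 1 0 1))
  have hA : Acal c0 M (11 / 60) b 5 Λ n 0 = ∑' r, c0 * M⁻¹ ^ (n + 2) *
      (dampedMass M⁻¹ r * stepMass (r + (n + 1))) := by
    rw [Acal, lp.inner_eq_tsum, ← hsum.sum_add_tsum_nat_add (n + 1), Finset.sum_eq_zero]
    · rw [Nat.cast_zero, zero_add, zero_add, one_div_one, one_mul]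
      refine tsum_congr fun r => ?_
      rw [key, if_pos (by omega), Nat.add_sub_cancel, dampedMass]
      ring
    · intro m hm
      rw [Finset.mem_range] at hm
      rw [key, if_neg (by omega)]; ring
  have hle : ∀ r, c0 * M⁻¹ ^ (n + 2) * (dampedMass M⁻¹ r * stepMass (r + (n + 1))) ≤
      c0 * M⁻¹ ^ (n + 2) * (1 / 2) ^ r := by
    intro r
    have h1 : M⁻¹ ^ r ≤ (1 / 2) ^ r := pow_le_pow_left₀ hq0.le hq r
    have h2 : dampedMass M⁻¹ r * stepMass (r + (n + 1)) ≤ (1 / 2) ^ r * 1 * 1 := by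
      unfold dampedMass
      have := stepMass_ge r
      have := stepMass_ge (r + (n + 1))
      gcongr <;> first | linarith | exact stepMass_le_one _
    have h3 : 0 ≤ c0 * M⁻¹ ^ (n + 2) := by positivity
    nlinarith
  have hpos : ∀ r, 0 < c0 * M⁻¹ ^ (n + 2) * (dampedMass M⁻¹ r * stepMass (r + (n + 1))) := by
    intro r
    have h1 : 0 < stepMass r := by linarith [stepMass_ge r]
    have h2 : 0 < stepMass (r + (n + 1)) := by linarith [stepMass_ge (r + (n + 1))]
    unfold dampedMass
    positivity
  have hgeo := hasSum_geometric_two.mul_left (c0 * M⁻¹ ^ (n + 2))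
  have hs := Summable.of_nonneg_of_le (fun r => (hpos r).le) hle hgeo.summable
  rw [hA]
  refine ⟨hs.tsum_pos (fun r => (hpos r).le) 0 (hpos 0), ?_⟩
  calc _ ≤ _ := hs.tsum_le_tsum hle hgeo.summable
    _ = _ := by rw [hgeo.tsum_eq]; ring

end Operator

lemma dampedMass_ge {q : ℝ} (hq : 0 ≤ q) (r : ℕ) : q ^ r / 12 ≤ dampedMass q r := by
  unfold dampedMass
  nlinarith [stepMass_ge r, pow_nonneg hq r]

lemma dampedMass_le {q : ℝ} (hq : 0 ≤ q) (r : ℕ) : dampedMass q r ≤ q ^ r := by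
  unfold dampedMass
  nlinarith [stepMass_le_one r, pow_nonneg hq r]

lemma dampedMass_pos {q : ℝ} (hq : 0 < q) (r : ℕ) : 0 < dampedMass q r :=
  lt_of_lt_of_le (by positivity) (dampedMass_ge hq.le r)

lemma sum_dampedMass_mul_stepWeight_lt {q : ℝ} (hq0 : 0 < q) (hq : q ≤ 1 / 2) (t : ℕ) :
    ∑ s ∈ Finset.range 6, dampedMass q (t + 1 + s) * stepWeight s <
      ∑ s ∈ Finset.range 6, dampedMass q (t + s) * stepWeight s := by
  have h0 := dampedMass_ge hq0.le t
  have h1 := dampedMass_pos hq0 (t + 1)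
  have h6 := dampedMass_le hq0.le (t + 6)
  have h7 : q ^ (t + 6) ≤ q ^ t * (1 / 2) ^ 6 := by
    rw [pow_add]; gcongr
  have h8 : 0 < q ^ t := by positivity
  have e : ∀ s, t + 1 + s = t + (s + 1) := fun s => by ring
  simp only [Finset.sum_range_succ, Finset.sum_range_zero, e]
  norm_num [stepWeight] at h7 ⊢
  linarith

lemma sum_dampedMass_mul_stepWeight_zero_lt {q : ℝ} (hq0 : 0 < q) (hq : q ≤ 1 / 2) :
    ∑ s ∈ Finset.range 6, dampedMass q (0 + s) * stepWeight s <
      11 / 60 * ∑ r ∈ Finset.range 5, dampedMass q r := by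
  have h0 : dampedMass q 0 = 1 / 12 := by rw [dampedMass, stepMass_zero]; ring
  have h5 := dampedMass_le hq0.le 5
  have h7 : q ^ 5 ≤ (1 / 2) ^ 5 := by gcongr
  simp only [Finset.sum_range_succ, Finset.sum_range_zero, h0]
  norm_num [stepWeight, h0] at h7 ⊢
  linarith

/-- A sequence vanishing on `[1, n - 4)`, with increments at least `ε` on `[max 1 (n - 3), n + 1]`,
decreasing and positive afterwards, and with `0 < a 0 < ε`, peaks at `n + 1`. -/
lemma peak_profile {a : ℕ → ℝ} {n : ℕ} {ε : ℝ} (h0 : 0 < a 0) (h0ε : a 0 < ε)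
    (hzero : ∀ i, i + 5 ≤ n → a (i + 1) = 0)
    (hpos : ∀ i, i ≤ n → n ≤ i + 4 → ε ≤ a (i + 1))
    (hinc : ∀ i, i < n → n ≤ i + 4 → a (i + 1) + ε ≤ a (i + 2))
    (hdec : ∀ j, n + 2 ≤ j → 0 < a j ∧ a j < a (j - 1)) :
    (∀ j, |a j| ≤ a (n + 1)) ∧
      ∃ j0 : ℕ, 2 ≤ j0 ∧ j0 ≤ n + 2 ∧ a (j0 - 1) ≠ 0 ∧
        (∀ j : ℕ, 2 ≤ j → j < j0 → a (j - 1) = 0) ∧ 0 < a 0 ∧ a 0 < a (j0 - 1) ∧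
        (∀ j : ℕ, j0 ≤ j → j < n + 2 → a (j - 1) < a j) ∧
        (j0 < n + 2 → 0 < a 0 + a (j0 - 1) ∧ a 0 + a (j0 - 1) < a j0) ∧
        (∀ j : ℕ, n + 2 ≤ j → 0 < a j ∧ a j < a (j - 1)) := by
  have hup : ∀ t i, i + t = n → n ≤ i + 4 → a (i + 1) ≤ a (n + 1) := by
    intro t
    induction t with
    | zero => rintro i rfl -; exact le_rfl
    | succ t ih =>
      intro i hit hin
      linarith [ih (i + 1) (by omega) (by omega), hinc i (by omega) hin]
  have hdown : ∀ t, a (n + 1 + t) ≤ a (n + 1) := by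
    intro t
    induction t with
    | zero => exact le_rfl
    | succ t ih => exact (hdec (n + 1 + (t + 1)) (by omega)).2.le.trans ih
  have htop := hpos n le_rfl (by omega)
  refine ⟨fun j => ?_, max 2 (n - 2), by omega, by omega, ?_⟩
  · rcases j with _ | i
    · rw [abs_of_pos h0]; linarith
    · rcases le_or_gt (i + 5) n with hi | hi
      · rw [hzero i hi, abs_zero]; linarith
      · rcases le_or_gt i n with hin | hin
        · rw [abs_of_nonneg (by linarith [hpos i hin (by omega)])]
          exact hup (n - i) i (by omega) (by omega)
        · rw [abs_of_pos (hdec (i + 1) (by omega)).1]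
          obtain ⟨t, rfl⟩ := Nat.exists_eq_add_of_le hin.le
          have := hdown t
          rwa [show n + 1 + t = n + t + 1 by ring] at this
  obtain ⟨i, hi, hin, hin4, hfirst⟩ : ∃ i, max 2 (n - 2) = i + 2 ∧ i ≤ n ∧ n ≤ i + 4 ∧
      ∀ l, l < i → l + 5 ≤ n :=
    ⟨max 2 (n - 2) - 2, by omega, by omega, by omega, fun l hl => by omega⟩
  rw [hi, show i + 2 - 1 = i + 1 by omega]
  have hp := hpos i hin hin4
  refine ⟨by linarith, ?_, h0, by linarith, ?_, ?_, hdec⟩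
  · intro j hj hji
    obtain ⟨l, rfl⟩ := Nat.exists_eq_add_of_le' hj
    exact hzero l (hfirst l (by omega))
  · intro j hij hjn
    obtain ⟨l, rfl⟩ := Nat.exists_eq_add_of_le' (show 2 ≤ j by omega)
    linarith [hinc l (by omega) (by omega), show a (l + 2 - 1) = a (l + 1) from rfl]
  · intro hlt
    exact ⟨by linarith, by linarith [hinc i (by omega) hin4]⟩

/-- Claim 4.4.  For every `M ≥ 2`, `α₀ > 0` and `k = 5` there are
constants `c₀, b > 0` and `0 < δ < 1/k` such that the numbers `A_{j,n₁}` (with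
`n₁ = n+2` and `λ_n = α₀ M^n`) satisfy `|A_{j,n₁}| ≤ A_{n₁,n₁} = 1/(2λ_n) = M²/(2α₀M^{n₁})`
for all `j ≥ 1`, together with the monotonicity properties around `j(n₁)` and beyond `n₁`. -/
theorem statement15 (M α0 : ℝ) (hM : 2 ≤ M) (hα0 : 0 < α0) (k : ℕ) (hk : k = 5) :
    ∃ c0 b δ : ℝ, 0 < c0 ∧ 0 < b ∧ 0 < δ ∧ δ < 1 / k ∧
      ∀ Λ : lp (fun _ : ℕ => ℝ) 1 →L[ℝ] lp (fun _ : ℕ => ℝ) 2,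
        lpSpec c0 M δ b k Λ →
        ∀ n : ℕ,
          (∀ j : ℕ, |Acal c0 M δ b k Λ n j| ≤ Acal c0 M δ b k Λ n (n + 1)) ∧
          Acal c0 M δ b k Λ n (n + 1) = 1 / (2 * (α0 * M ^ n)) ∧
          Acal c0 M δ b k Λ n (n + 1) = M ^ 2 / (2 * α0 * M ^ (n + 2)) ∧
          ∃ j0 : ℕ, 2 ≤ j0 ∧ j0 ≤ n + 2 ∧
            Acal c0 M δ b k Λ n (j0 - 1) ≠ 0 ∧
            (∀ j : ℕ, 2 ≤ j → j < j0 → Acal c0 M δ b k Λ n (j - 1) = 0) ∧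
            0 < Acal c0 M δ b k Λ n 0 ∧
            Acal c0 M δ b k Λ n 0 < Acal c0 M δ b k Λ n (j0 - 1) ∧
            (∀ j : ℕ, j0 ≤ j → j < n + 2 →
              Acal c0 M δ b k Λ n (j - 1) < Acal c0 M δ b k Λ n j) ∧
            (j0 < n + 2 →
              0 < Acal c0 M δ b k Λ n 0 + Acal c0 M δ b k Λ n (j0 - 1) ∧
              Acal c0 M δ b k Λ n 0 + Acal c0 M δ b k Λ n (j0 - 1) <
                Acal c0 M δ b k Λ n j0) ∧
            (∀ j : ℕ, n + 2 ≤ j →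
              0 < Acal c0 M δ b k Λ n j ∧
              Acal c0 M δ b k Λ n j < Acal c0 M δ b k Λ n (j - 1)) := by
  subst hk
  have hM0 : 0 < M := by linarith
  have hq0 : 0 < M⁻¹ := inv_pos.mpr hM0
  have hq : M⁻¹ ≤ 1 / 2 := by rw [one_div]; exact inv_anti₀ (by norm_num) hM
  have hmass : ∀ t < 5, dampedMass M⁻¹ 0 ≤ ∑ r ∈ Finset.range (5 - t), dampedMass M⁻¹ r :=
    fun t ht => Finset.single_le_sum (f := dampedMass M⁻¹)
      (fun r _ => (dampedMass_pos hq0 r).le) (by rw [Finset.mem_range]; omega)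
  have hmass_pos : 0 < ∑ r ∈ Finset.range 5, dampedMass M⁻¹ r :=
    (dampedMass_pos hq0 0).trans_le (hmass 0 (by norm_num))
  have hge : ∀ r ≤ 4, M⁻¹ ^ 4 / 12 ≤ dampedMass M⁻¹ r := fun r hr => by
    have := pow_le_pow_of_le_one hq0.le (by linarith) hr
    linarith [dampedMass_ge hq0.le r]
  obtain ⟨b, hb_def⟩ : ∃ b : ℝ, b = M⁻¹ ^ 4 / 1000 := ⟨_, rfl⟩
  obtain ⟨c0, hc_def⟩ : ∃ c0 : ℝ, c0 = b * M ^ 2 /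
    (2 * α0 * (11 / 60 * ∑ r ∈ Finset.range 5, dampedMass M⁻¹ r)) := ⟨_, rfl⟩
  have hb : 0 < b := by rw [hb_def]; positivity
  have hc : 0 < c0 := by rw [hc_def]; positivity
  refine ⟨c0, b, 11 / 60, hc, hb, by norm_num, by norm_num, fun Λ hΛ n => ?_⟩
  have hadd := Acal_add hb.ne' hc.le hM0.le hΛ n
  have hsub := fun i t => Acal_sub (i := i) (t := t) hb.ne' hc.le hM0.le hΛ (n := n)
  obtain ⟨h0, h0'⟩ := Acal_zero_bounds hb.ne' hc hM hΛ n
  have hpeak : Acal c0 M (11 / 60) b 5 Λ n (n + 1) = 1 / (2 * (α0 * M ^ n)) := by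
    rw [hsub n 0 rfl, hc_def, inv_pow, pow_add, Nat.sub_zero]
    generalize ∑ r ∈ Finset.range 5, dampedMass M⁻¹ r = S at hmass_pos
    field_simp
  obtain ⟨K, hK⟩ : ∃ K, K = c0 * M⁻¹ ^ (n + 2) / b := ⟨_, rfl⟩
  have hKpos : 0 < K := by rw [hK]; positivity
  rw [show c0 * M⁻¹ ^ (n + 2) = K * b by rw [hK]; field_simp] at h0'
  rw [← hK] at hadd hsub
  have hprofile := peak_profile (a := Acal c0 M (11 / 60) b 5 Λ n) (n := n)
    (ε := K * (11 / 60 * (M⁻¹ ^ 4 / 12))) h0 ?_ ?_ ?_ ?_ ?_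
  · refine ⟨hprofile.1, hpeak, ?_, hprofile.2⟩
    rw [hpeak, pow_add]
    field_simp
  · have : 0 < K * M⁻¹ ^ 4 := by positivity
    have : K * b = K * M⁻¹ ^ 4 / 1000 := by rw [hb_def]; ring
    linarith
  · intro i hi
    rw [hsub i (n - i) (by omega), show 5 - (n - i) = 0 by omega]
    simp
  · intro i hi hin
    rw [hsub i (n - i) (by omega)]
    have := (hge 0 (by norm_num)).trans (hmass (n - i) (by omega))
    gcongr
  · intro i hi hin
    obtain ⟨t, ht⟩ : ∃ t, i + 1 + t = n := ⟨n - (i + 1), by omega⟩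
    rw [hsub i (t + 1) (by omega), hsub (i + 1) t ht, ← mul_add, ← mul_add,
      show 5 - t = (5 - (t + 1)) + 1 by omega, Finset.sum_range_succ]
    have := hge (5 - (t + 1)) (by omega)
    gcongr
  · intro j hj
    obtain ⟨t, rfl⟩ := Nat.exists_eq_add_of_le hj
    refine ⟨?_, ?_⟩
    · rw [hadd t]
      refine mul_pos hKpos (Finset.sum_pos' (fun s _ => ?_) ⟨0, by simp, ?_⟩)
      · exact mul_nonneg (dampedMass_pos hq0 _).le (stepWeight_nonneg s)
      · exact mul_pos (dampedMass_pos hq0 _) (by norm_num [stepWeight])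
    · rcases t with _ | t
      · rw [hadd 0, show n + 2 + 0 - 1 = n + 1 by omega, hsub n 0 rfl]
        exact mul_lt_mul_of_pos_left (sum_dampedMass_mul_stepWeight_zero_lt hq0 hq) hKpos
      · rw [hadd (t + 1), show n + 2 + (t + 1) - 1 = n + 2 + t by omega, hadd t]
        exact mul_lt_mul_of_pos_left (sum_dampedMass_mul_stepWeight_lt hq0 hq t) hKpos
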